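/- Let (C_n) and (C'_n) be sequences where C_n and C'_n are conjugacy classes of the symmetric group S_n, with cycle counts c_j(n) and c'_j(n) respectively. If liminf_{n→∞} P_n > 0, where P_n is the probability that two independent uniformly random elements π ∈ C_n and π' ∈ C'_n generate a subgroup containing A_n, then (c_1(n) + c_2(n)^{1/2})(c'_1(n) + c'_2(n)^{1/2}) = O(n) and limsup_{n→∞} (c_2(n) + c'_2(n))/n < 1. -/

import Mathlib

open Filter Asymptotics

/-- The number of `j`-cycles in the cycle decomposition of `π` (fixed points are `1`-cycles). -/
noncomputable def cycleCount {n : ℕ} (π : Equiv.Perm (Fin n)) (j : ℕ) : ℕ :=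
  if j = 1 then Nat.card (Function.fixedPoints ⇑π) else Multiset.count j π.cycleType

/-- The probability that, for `π₁` uniform in the conjugacy class of `π` and `π₂` uniform and
independent in the conjugacy class of `π'`, the subgroup `⟨π₁, π₂⟩` contains `A_n`. -/
noncomputable def genProb (n : ℕ) (π π' : Equiv.Perm (Fin n)) : ℝ :=
  (Nat.card {p : Equiv.Perm (Fin n) × Equiv.Perm (Fin n) //
      IsConj π p.1 ∧ IsConj π' p.2 ∧
      alternatingGroup (Fin n) ≤ Subgroup.closure {p.1, p.2}} : ℝ) /
  ((Nat.card {σ : Equiv.Perm (Fin n) // IsConj π σ} : ℝ) *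
   (Nat.card {σ : Equiv.Perm (Fin n) // IsConj π' σ} : ℝ))

section Auxiliary

open Equiv Finset Topology

section Counting
variable {α J : Type*} [Fintype α] [DecidableEq α] [Fintype J]

theorem exists_perm_apply_embedding_eq (a b : J ↪ α) : ∃ g : Perm α, ∀ j, g (a j) = b j := by
  classical
  let e : {x // x ∈ Set.range a} ≃ {x // x ∈ Set.range b} :=
    (Equiv.ofInjective a a.injective).symm.trans (Equiv.ofInjective b b.injective)
  refine ⟨e.extendSubtype, fun j => ?_⟩
  rw [Equiv.extendSubtype_apply_of_mem e _ (Set.mem_range_self j)]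
  have : (⟨a j, Set.mem_range_self j⟩ : {x // x ∈ Set.range a}) =
      Equiv.ofInjective a a.injective j := rfl
  simp only [e, Equiv.trans_apply, this, Equiv.symm_apply_apply]
  rfl

theorem descFactorial_card_pos {β : Type*} [Fintype β] (b : J ↪ β) :
    (0 : ℝ) < (Fintype.card β).descFactorial (Fintype.card J) := by
  exact_mod_cast Nat.descFactorial_pos.2 (Fintype.card_le_of_embedding b)

open Classical in
/-- Summed over all permutations `σ`, the indicator of `σ ∘ b = a` is `n! / n (n-1) ⋯ (n-|J|+1)`. -/
theorem sum_perm_indicator_extends (a b : J ↪ α) :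
    ∑ σ : Perm α, (if ∀ j, σ (b j) = a j then (1 : ℝ) else 0) =
      (Fintype.card (Perm α) : ℝ) / (Fintype.card α).descFactorial (Fintype.card J) := by
  have hconst (a' : J ↪ α) : ∑ σ : Perm α, (if ∀ j, σ (b j) = a' j then (1 : ℝ) else 0) =
      ∑ σ : Perm α, (if ∀ j, σ (b j) = a j then (1 : ℝ) else 0) := by
    obtain ⟨g, hg⟩ := exists_perm_apply_embedding_eq a a'
    refine (Fintype.sum_equiv (Equiv.mulLeft g) _ _ fun σ => ?_).symm
    simp [← hg]
  have htotal : ∑ a' : J ↪ α, ∑ σ : Perm α, (if ∀ j, σ (b j) = a' j then (1 : ℝ) else 0) =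
      Fintype.card (Perm α) := by
    rw [sum_comm]
    have (σ : Perm α) : ∑ a' : J ↪ α, (if ∀ j, σ (b j) = a' j then (1 : ℝ) else 0) = 1 := by
      rw [sum_eq_single (b.trans σ.toEmbedding)]
      · simp
      · intro a' _ h
        rw [if_neg]
        intro h'
        exact h (by ext j; simp [h'])
      · simp
    simp [this]
  simp only [hconst] at htotal
  rw [sum_const, card_univ, Fintype.card_embedding_eq, nsmul_eq_mul] at htotal
  rw [eq_div_iff (descFactorial_card_pos b).ne', ← htotal, mul_comm]

open Classical in
theorem sum_perm_indicator_mapsTo (b : J ↪ α) (F : Finset α) :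
    ∑ σ : Perm α, (if ∀ j, σ (b j) ∈ F then (1 : ℝ) else 0) =
      Fintype.card (Perm α) * ((#F).descFactorial (Fintype.card J) /
        (Fintype.card α).descFactorial (Fintype.card J)) := by
  have (σ : Perm α) : (if ∀ j, σ (b j) ∈ F then (1 : ℝ) else 0) =
      ∑ a : J ↪ F, (if ∀ j, σ (b j) = a.trans (.subtype _) j then (1 : ℝ) else 0) := by
    split_ifs with h
    · rw [sum_eq_single ⟨fun j => ⟨σ (b j), h j⟩, fun i j hij => by simpa using hij⟩]
      · exact (if_pos fun j => rfl).symm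
      · intro a' _ h
        rw [if_neg]
        intro h'
        exact h (by ext j; simp [h'])
      · simp
    · refine (sum_eq_zero fun a _ => if_neg fun h' => h fun j => ?_).symm
      rw [h' j]
      exact (a j).2
  simp only [this]
  rw [sum_comm]
  simp only [sum_perm_indicator_extends]
  rw [sum_const, card_univ, Fintype.card_embedding_eq, nsmul_eq_mul, Fintype.card_coe]
  ring

/-- The Cauchy–Schwarz form of the second moment method. -/
theorem card_mul_le_of_second_moment {Ω : Type*} [Fintype Ω] [DecidableEq Ω] [Nonempty Ω]
    (G : Finset Ω) (Y : Ω → ℝ) (hG : ∀ ω ∈ G, Y ω = 0) {μ Q : ℝ}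
    (h₁ : ∑ ω, Y ω = Fintype.card Ω * μ) (h₂ : ∑ ω, Y ω ^ 2 ≤ Fintype.card Ω * Q) :
    #G * Q ≤ Fintype.card Ω * (Q - μ ^ 2) := by
  have hN : (0 : ℝ) < Fintype.card Ω := by exact_mod_cast Fintype.card_pos
  have hsum : ∑ ω, Y ω = ∑ ω ∈ Gᶜ, Y ω := by
    rw [← sum_add_sum_compl G, sum_eq_zero hG, zero_add]
  have hsq : ∑ ω ∈ Gᶜ, Y ω ^ 2 ≤ ∑ ω, Y ω ^ 2 :=
    sum_le_sum_of_subset_of_nonneg (subset_univ _) fun _ _ _ => sq_nonneg _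
  have hcs := sq_sum_le_card_mul_sum_sq (s := Gᶜ) (f := Y)
  rw [← hsum, h₁] at hcs
  have hc : (#Gᶜ : ℝ) = Fintype.card Ω - #G := by
    rw [card_compl, Nat.cast_sub (card_le_univ _)]
  have : (Fintype.card Ω * μ) ^ 2 ≤ #Gᶜ * (Fintype.card Ω * Q) :=
    hcs.trans (mul_le_mul_of_nonneg_left (hsq.trans h₂) (Nat.cast_nonneg _))
  rw [hc] at this
  refine le_of_mul_le_mul_left ?_ hN
  nlinarith

/-- Two permutations with a common proper invariant subset do not generate `A_n`. -/
theorem not_alternatingGroup_le_closure (hα : 3 ≤ Fintype.card α) {p q : Perm α} (S : Finset α)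
    (hS : S.Nonempty) (hS' : #S < Fintype.card α) (hp : ∀ x ∈ S, p x ∈ S)
    (hq : ∀ x ∈ S, q x ∈ S) : ¬ alternatingGroup α ≤ Subgroup.closure {p, q} := by
  intro h
  obtain ⟨x, hx⟩ := hS
  obtain ⟨y, hy⟩ : ∃ y, y ∉ S := by
    by_contra! h'
    exact hS'.ne (by rw [eq_univ_iff_forall.2 h', card_univ])
  obtain ⟨z, hz⟩ : ∃ z, z ∉ ({x, y} : Finset α) := by
    by_contra! h'
    have := card_le_two (a := x) (b := y)
    rw [eq_univ_iff_forall.2 h', card_univ] at this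
    omega
  simp only [mem_insert, mem_singleton, not_or] at hz
  have hxy : x ≠ y := fun h => hy (h ▸ hx)
  have hg : swap x y * swap y z ∈ alternatingGroup α := by
    rw [Equiv.Perm.mem_alternatingGroup, map_mul, Equiv.Perm.sign_swap hxy,
      Equiv.Perm.sign_swap (Ne.symm hz.2)]
    rfl
  have himage (r : Perm α) (hr : ∀ x ∈ S, r x ∈ S) : S.map r.toEmbedding = S :=
    eq_of_subset_of_card_le (fun w hw => by
      obtain ⟨v, hv, rfl⟩ := mem_map.1 hw
      exact hr v hv) (card_map _).ge
  have hinv : ∀ g ∈ Subgroup.closure {p, q}, ∀ w, g w ∈ S ↔ w ∈ S := by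
    have hgen (r : Perm α) (hr : ∀ x ∈ S, r x ∈ S) (w : α) : r w ∈ S ↔ w ∈ S := by
      conv_lhs => rw [← himage r hr]
      simp
    intro g hg
    induction hg using Subgroup.closure_induction with
    | mem r hr =>
      rcases hr with rfl | rfl
      · exact hgen _ hp
      · exact hgen _ hq
    | one => simp
    | mul a b _ _ ha hb => intro w; rw [Perm.mul_apply, ha, hb]
    | inv a _ ha => intro w; rw [← ha]; simp
  have := (hinv _ (h hg) x).2 hx
  rw [Perm.mul_apply, swap_apply_of_ne_of_ne hxy (Ne.symm hz.1), swap_apply_left] at this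
  exact hy this

end Counting

section CommonInvariantSets
variable {α : Type*} [Fintype α] [DecidableEq α]

theorem descFactorial_add_mul_le {c n q : ℕ} (hcn : c ≤ n) (r : ℕ) :
    c.descFactorial (q + r) * (n.descFactorial q * n.descFactorial r) ≤
      c.descFactorial q * c.descFactorial r * n.descFactorial (q + r) := by
  induction r with
  | zero => simp
  | succ r ih =>
    rw [← add_assoc, Nat.descFactorial_succ, Nat.descFactorial_succ, Nat.descFactorial_succ,
      Nat.descFactorial_succ]
    have hstep : (c - (q + r)) * (n - r) ≤ (c - r) * (n - (q + r)) := by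
      rcases le_total c (q + r) with h | h
      · simp [Nat.sub_eq_zero_of_le h]
      · obtain ⟨d, rfl⟩ := Nat.exists_eq_add_of_le h
        obtain ⟨m, rfl⟩ := Nat.exists_eq_add_of_le hcn
        rw [show q + r + d - (q + r) = d by omega, show q + r + d + m - r = q + d + m by omega,
          show q + r + d - r = q + d by omega, show q + r + d + m - (q + r) = d + m by omega]
        nlinarith [Nat.zero_le (q * m)]
    calc _ = ((c - (q + r)) * (n - r)) * (c.descFactorial (q + r) *
            (n.descFactorial q * n.descFactorial r)) := by ring
      _ ≤ ((c - r) * (n - (q + r))) * (c.descFactorial q * c.descFactorial r *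
            n.descFactorial (q + r)) := Nat.mul_le_mul hstep ih
      _ = _ := by ring

open Classical in
/-- If `p` has many fixed points and `τ` many disjoint invariant `q`-sets, then `p` and a random
conjugate of `τ` are unlikely to generate `A_n`. -/
theorem card_generating_mul_le_of_fixed {m q : ℕ} (hα : 3 ≤ Fintype.card α) (hq : 1 ≤ q)
    (hqα : q < Fintype.card α) (p τ : Perm α) (b : Fin m × Fin q ↪ α)
    (hb : ∀ t j, ∃ j', τ (b (t, j)) = b (t, j')) (F : Finset α) (hF : ∀ x ∈ F, p x = x) :
    (#{σ : Perm α | alternatingGroup α ≤ Subgroup.closure {p, σ * τ * σ⁻¹}} : ℝ) *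
      (1 + m * ((#F).descFactorial q / (Fintype.card α).descFactorial q : ℝ)) ≤
      (Fintype.card (Perm α) : ℝ) := by
  set N : ℝ := (Fintype.card (Perm α) : ℝ) with hN
  set G : Finset (Perm α) := {σ | alternatingGroup α ≤ Subgroup.closure {p, σ * τ * σ⁻¹}}
  set r : ℝ := (#F).descFactorial q / (Fintype.card α).descFactorial q with hr
  have hr0 : 0 ≤ r := by positivity
  have hN0 : 0 ≤ N := by positivity
  let row (t : Fin m) : Fin q ↪ α := ⟨fun j => b (t, j), fun i j h => by simpa using h⟩
  let I (t : Fin m) (σ : Perm α) : ℝ := if ∀ j, σ (row t j) ∈ F then 1 else 0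
  have hI (t : Fin m) : ∑ σ, I t σ = N * r := by
    have h := sum_perm_indicator_mapsTo (row t) F
    rw [Fintype.card_fin] at h
    convert h
  have hII (t t' : Fin m) : ∑ σ, I t σ * I t' σ ≤ N * (r ^ 2 + if t = t' then r else 0) := by
    split_ifs with h
    · subst h
      have : ∀ σ, I t σ * I t σ = I t σ := fun σ => by simp only [I]; split_ifs <;> simp
      simp only [this, hI]
      nlinarith [mul_nonneg hN0 (sq_nonneg r)]
    · let rows : Fin q ⊕ Fin q ↪ α := ⟨Sum.elim (row t) (row t'), by
        refine Function.Injective.sumElim (row t).injective (row t').injective fun i j hij => h ?_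
        have := b.injective hij
        exact (Prod.ext_iff.1 this).1⟩
      have : ∀ σ, I t σ * I t' σ = if ∀ j, σ (rows j) ∈ F then 1 else 0 := fun σ => by
        simp only [I, rows, Function.Embedding.coeFn_mk, Sum.forall, Sum.elim_inl, Sum.elim_inr,
          ite_and]
        split_ifs <;> simp
      simp only [this, sum_perm_indicator_mapsTo, Fintype.card_sum, Fintype.card_fin, add_zero]
      refine mul_le_mul_of_nonneg_left ?_ hN0
      have h1 := descFactorial_add_mul_le (q := q) (card_le_univ F) q
      have hpos : 0 < (Fintype.card α).descFactorial q := Nat.descFactorial_pos.2 hqα.le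
      have h2 := descFactorial_card_pos rows
      simp only [Fintype.card_sum, Fintype.card_fin] at h2
      rw [hr, div_pow, div_le_div_iff₀ h2 (by positivity)]
      rw [sq, sq]
      exact_mod_cast h1
  let X (σ : Perm α) : ℝ := ∑ t, I t σ
  have h₁ : ∑ σ, X σ = N * (m * r) := by
    simp only [X]
    rw [sum_comm]
    simp only [hI, sum_const, card_univ, Fintype.card_fin, nsmul_eq_mul]
    ring
  have h₂ : ∑ σ, X σ ^ 2 ≤ N * ((m * r) ^ 2 + m * r) := by
    calc ∑ σ, X σ ^ 2 = ∑ t, ∑ t', ∑ σ, I t σ * I t' σ := by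
          simp only [X, sq, sum_mul_sum]
          rw [sum_comm]
          exact sum_congr rfl fun t _ => sum_comm
      _ ≤ ∑ t : Fin m, ∑ t' : Fin m, N * (r ^ 2 + if t = t' then r else 0) :=
          sum_le_sum fun t _ => sum_le_sum fun t' _ => hII t t'
      _ = N * ((m * r) ^ 2 + m * r) := by
          simp only [← mul_sum, sum_add_distrib, sum_ite_eq, mem_univ, if_true, sum_const,
            card_univ, Fintype.card_fin, nsmul_eq_mul]
          ring
  have hG : ∀ σ ∈ G, X σ = 0 := by
    intro σ hσ
    refine sum_eq_zero fun t _ => if_neg fun h => ?_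
    refine not_alternatingGroup_le_closure hα (univ.map ((row t).trans σ.toEmbedding)) ?_ ?_ ?_ ?_
      (mem_filter.1 hσ).2
    · exact ⟨σ (row t ⟨0, hq⟩), mem_map.2 ⟨_, mem_univ _, rfl⟩⟩
    · simpa using hqα
    · intro x hx
      obtain ⟨j, -, rfl⟩ := mem_map.1 hx
      exact (hF _ (h j)).symm ▸ hx
    · intro x hx
      obtain ⟨j, -, rfl⟩ := mem_map.1 hx
      obtain ⟨j', hj'⟩ := hb t j
      refine mem_map.2 ⟨j', mem_univ _, ?_⟩
      change σ (b (t, j')) = (σ * τ * σ⁻¹) (σ (b (t, j)))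
      simp [hj']
  have key := card_mul_le_of_second_moment G X hG h₁ h₂
  rcases (mul_nonneg (Nat.cast_nonneg m) hr0 : (0 : ℝ) ≤ m * r).eq_or_lt with h0 | h0
  · rw [← h0]
    simpa [N] using (Nat.cast_le (α := ℝ)).2 (card_le_univ G)
  · refine le_of_mul_le_mul_right ?_ h0
    rw [← hN] at key
    linarith

end CommonInvariantSets

section AlternatingCycles
variable {α : Type*}

/-- The shift along a cycle on `2 (k + 1)` vertices, whose edges `{(i, false), (i, true)}`
alternate with the edges `{(i, true), (i + 1, false)}`. -/
def altShift (k : ℕ) : Fin (k + 1) × Bool ≃ Fin (k + 1) × Bool where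
  toFun x := if x.2 then (x.1 + 1, false) else (x.1, true)
  invFun x := if x.2 then (x.1, false) else (x.1 - 1, true)
  left_inv := by rintro ⟨i, _ | _⟩ <;> simp
  right_inv := by rintro ⟨i, _ | _⟩ <;> simp

/-- `a` runs through a closed cycle whose edges are alternately `2`-cycles of `p` and of `ρ`. -/
structure IsAltCycle (p ρ : Perm α) {k : ℕ} (a : Fin (k + 1) × Bool ↪ α) : Prop where
  left : ∀ i b, p (a (i, b)) = a (i, !b)
  right : ∀ i b, ρ (a (altShift k (i, b))) = a (altShift k (i, !b))

namespace IsAltCycle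
variable {p ρ : Perm α} {k l : ℕ} {a : Fin (k + 1) × Bool ↪ α} {a' : Fin (l + 1) × Bool ↪ α}

theorem left_mem (h : IsAltCycle p ρ a) {x : α} (hx : x ∈ Set.range a) : p x ∈ Set.range a := by
  obtain ⟨⟨i, b⟩, rfl⟩ := hx
  exact ⟨_, (h.left i b).symm⟩

theorem right_mem (h : IsAltCycle p ρ a) {x : α} (hx : x ∈ Set.range a) : ρ x ∈ Set.range a := by
  obtain ⟨y, rfl⟩ := hx
  obtain ⟨⟨i, b⟩, rfl⟩ := (altShift k).surjective y
  exact ⟨_, (h.right i b).symm⟩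

theorem apply_succ_false (h : IsAltCycle p ρ a) (i : Fin k) :
    a (i.succ, false) = ρ (p (a (i.castSucc, false))) := by
  rw [h.left]
  have h2 := h.right i.castSucc false
  simpa [altShift, Fin.coeSucc_eq_succ] using h2.symm

theorem eq_of_apply_zero_eq (h : IsAltCycle p ρ a) {a' : Fin (k + 1) × Bool ↪ α}
    (h' : IsAltCycle p ρ a') (h0 : a (0, false) = a' (0, false)) : a = a' := by
  have hf (i : Fin (k + 1)) : a (i, false) = a' (i, false) := by
    induction i using Fin.induction with
    | zero => exact h0
    | succ i ih => rw [h.apply_succ_false, h'.apply_succ_false, ih]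
  ext ⟨i, _ | _⟩
  · exact hf i
  · have h1 := h.left i false
    have h2 := h'.left i false
    rw [hf i, h2] at h1
    exact h1.symm

theorem mem_iff (h : IsAltCycle p ρ a) {S : Set α} (hp : ∀ x ∈ S, p x ∈ S)
    (hρ : ∀ x ∈ S, ρ x ∈ S) (x : Fin (k + 1) × Bool) : a x ∈ S ↔ a (0, false) ∈ S := by
  have hflip (i : Fin (k + 1)) : a (i, true) ∈ S ↔ a (i, false) ∈ S :=
    ⟨fun hx => by simpa [h.left] using hp _ hx, fun hx => by simpa [h.left] using hp _ hx⟩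
  have hstep (i : Fin k) : a (i.succ, false) ∈ S ↔ a (i.castSucc, true) ∈ S := by
    have h1 := h.right i.castSucc true
    have h2 := h.right i.castSucc false
    simp only [altShift, Fin.coeSucc_eq_succ, Equiv.coe_fn_mk, if_true, Bool.not_true,
      Bool.not_false, Bool.false_eq_true, if_false] at h1 h2
    exact ⟨fun hx => h1 ▸ hρ _ hx, fun hx => h2 ▸ hρ _ hx⟩
  have hf (i : Fin (k + 1)) : a (i, false) ∈ S ↔ a (0, false) ∈ S := by
    induction i using Fin.induction with
    | zero => rfl
    | succ i ih => rw [hstep, hflip, ih]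
  obtain ⟨i, _ | _⟩ := x
  · exact hf i
  · rw [hflip, hf]

theorem range_subset (h : IsAltCycle p ρ a) (h' : IsAltCycle p ρ a')
    (hd : ¬ Disjoint (Set.range a) (Set.range a')) : Set.range a ⊆ Set.range a' := by
  obtain ⟨_, ⟨x, rfl⟩, hx⟩ := Set.not_disjoint_iff.1 hd
  have hiff := h.mem_iff (S := Set.range a') (fun _ => h'.left_mem) (fun _ => h'.right_mem)
  rintro _ ⟨y, rfl⟩
  rwa [hiff, ← hiff x]

theorem length_eq (h : IsAltCycle p ρ a) (h' : IsAltCycle p ρ a')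
    (hd : ¬ Disjoint (Set.range a) (Set.range a')) : k = l := by
  have heq := (h.range_subset h' hd).antisymm (h'.range_subset h fun hd' => hd hd'.symm)
  have := congrArg Set.ncard heq
  rw [Set.ncard_range_of_injective a.injective,
    Set.ncard_range_of_injective a'.injective] at this
  simp only [Nat.card_eq_fintype_card, Fintype.card_prod, Fintype.card_fin,
    Fintype.card_bool] at this
  omega

end IsAltCycle

variable [Fintype α] [DecidableEq α] {c c' : ℕ}

/-- Ordered choices of `k + 1` edges among `c`, with orientations. -/
abbrev OrientedEdges (c k : ℕ) : Type := (Fin (k + 1) ↪ Fin c) × (Fin (k + 1) → Bool)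

/-- The vertices of a choice of oriented edges. -/
def OrientedEdges.vertices (e : Fin c × Bool ↪ α) {k : ℕ} (u : OrientedEdges c k) :
    Fin (k + 1) × Bool ↪ α where
  toFun x := e (u.1 x.1, xor (u.2 x.1) x.2)
  inj' := by
    rintro ⟨i, b⟩ ⟨j, b'⟩ h
    have h := e.injective h
    simp only [Prod.mk.injEq, EmbeddingLike.apply_eq_iff_eq] at h
    obtain ⟨rfl, h⟩ := h
    simpa using h

omit [Fintype α] [DecidableEq α] in
theorem OrientedEdges.vertices_apply (e : Fin c × Bool ↪ α) {k : ℕ} (u : OrientedEdges c k)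
    (x : Fin (k + 1) × Bool) : u.vertices e x = e (u.1 x.1, xor (u.2 x.1) x.2) := rfl

omit [Fintype α] [DecidableEq α] in
theorem OrientedEdges.vertices_injective (e : Fin c × Bool ↪ α) (k : ℕ) :
    Function.Injective (OrientedEdges.vertices e (k := k)) := by
  rintro ⟨t, β⟩ ⟨t', β'⟩ h
  have h (i : Fin (k + 1)) := e.injective (DFunLike.congr_fun h (i, false))
  simp only [Bool.xor_false, Prod.mk.injEq] at h
  simp only [Prod.mk.injEq]
  exact ⟨by ext i; rw [(h i).1], funext fun i => (h i).2⟩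

theorem card_orientedEdges (c k : ℕ) :
    Fintype.card (OrientedEdges c k) = c.descFactorial (k + 1) * 2 ^ (k + 1) := by
  simp [OrientedEdges, Fintype.card_embedding_eq]

theorem card_orientedEdges_le {n : ℕ} (hc : 2 * c ≤ n) (k : ℕ) :
    Fintype.card (OrientedEdges c k) ≤ n ^ (k + 1) := by
  rw [card_orientedEdges]
  calc _ ≤ c ^ (k + 1) * 2 ^ (k + 1) := Nat.mul_le_mul_right _ (Nat.descFactorial_le_pow _ _)
    _ = (2 * c) ^ (k + 1) := by rw [← mul_pow, mul_comm]
    _ ≤ _ := Nat.pow_le_pow_left hc _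

/-- The choices of edges that close up to an alternating cycle when the second system of edges
is moved by `σ`. -/
def Closes (e : Fin c × Bool ↪ α) (e' : Fin c' × Bool ↪ α) {k : ℕ}
    (w : OrientedEdges c k × OrientedEdges c' k) (σ : Perm α) : Prop :=
  ∀ x, σ (w.2.vertices e' x) = w.1.vertices e (altShift k x)

section Closes
variable {p τ σ : Perm α} {e : Fin c × Bool ↪ α} {e' : Fin c' × Bool ↪ α} {k l : ℕ}
  {w : OrientedEdges c k × OrientedEdges c' k} {v : OrientedEdges c l × OrientedEdges c' l}

omit [Fintype α] [DecidableEq α]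

theorem Closes.isAltCycle (he : ∀ t b, p (e (t, b)) = e (t, !b))
    (he' : ∀ t b, τ (e' (t, b)) = e' (t, !b)) (h : Closes e e' w σ) :
    IsAltCycle p (σ * τ * σ⁻¹) (w.1.vertices e) where
  left i b := by simp [OrientedEdges.vertices_apply, he]
  right i b := by
    rw [← h, ← h]
    simp [OrientedEdges.vertices_apply, he']

theorem Closes.snd_eq {w' : OrientedEdges c k × OrientedEdges c' k} (h : Closes e e' w σ)
    (h' : Closes e e' w' σ) (h1 : w.1 = w'.1) : w = w' := by
  refine Prod.ext h1 (OrientedEdges.vertices_injective e' k ?_)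
  ext x
  apply σ.injective
  rw [h x, h' x, h1]

end Closes

open Classical in
theorem sum_perm_closes (e : Fin c × Bool ↪ α) (e' : Fin c' × Bool ↪ α) {k : ℕ}
    (w : OrientedEdges c k × OrientedEdges c' k) :
    ∑ σ : Perm α, (if Closes e e' w σ then (1 : ℝ) else 0) =
      Fintype.card (Perm α) / (Fintype.card α).descFactorial (2 * (k + 1)) := by
  have h := sum_perm_indicator_extends ((altShift k).toEmbedding.trans (w.1.vertices e))
    (w.2.vertices e')
  rw [Fintype.card_prod, Fintype.card_fin, Fintype.card_bool, mul_comm (k + 1)] at h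
  refine (sum_congr rfl fun σ _ => ?_).trans h
  congr

open Classical in
theorem sum_perm_closes_closes_le (e : Fin c × Bool ↪ α) (e' : Fin c' × Bool ↪ α) {k l : ℕ}
    (w : OrientedEdges c k × OrientedEdges c' k) (v : OrientedEdges c l × OrientedEdges c' l) :
    ∑ σ : Perm α, (if Closes e e' w σ ∧ Closes e e' v σ ∧
        Disjoint (Set.range (w.1.vertices e)) (Set.range (v.1.vertices e)) then (1 : ℝ) else 0) ≤
      Fintype.card (Perm α) / (Fintype.card α).descFactorial (2 * (k + 1) + 2 * (l + 1)) := by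
  by_cases hex : ∃ σ : Perm α, Closes e e' w σ ∧ Closes e e' v σ ∧
      Disjoint (Set.range (w.1.vertices e)) (Set.range (v.1.vertices e))
  · obtain ⟨σ₀, hw, hv, hd⟩ := hex
    rw [Set.disjoint_left] at hd
    let a : (Fin (k + 1) × Bool) ⊕ (Fin (l + 1) × Bool) ↪ α :=
      ⟨Sum.elim (fun x => w.1.vertices e (altShift k x)) (fun x => v.1.vertices e (altShift l x)),
        ((w.1.vertices e).injective.comp (altShift k).injective).sumElim
          ((v.1.vertices e).injective.comp (altShift l).injective)
          fun x y hxy => hd ⟨_, rfl⟩ ⟨_, hxy.symm⟩⟩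
    let b : (Fin (k + 1) × Bool) ⊕ (Fin (l + 1) × Bool) ↪ α :=
      ⟨Sum.elim (w.2.vertices e') (v.2.vertices e'),
        (w.2.vertices e').injective.sumElim (v.2.vertices e').injective
          fun x y hxy => hd ⟨_, rfl⟩ ⟨altShift l y, by rw [← hw, ← hv, hxy]⟩⟩
    have h := sum_perm_indicator_extends a b
    rw [Fintype.card_sum, Fintype.card_prod, Fintype.card_fin, Fintype.card_bool,
      Fintype.card_prod, Fintype.card_fin, Fintype.card_bool, mul_comm (k + 1),
      mul_comm (l + 1)] at h
    rw [← h]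
    refine sum_le_sum fun σ _ => ?_
    split_ifs with h1 h2 h2
    · rfl
    · exact absurd (Sum.forall.2 ⟨h1.1, h1.2.1⟩ : ∀ j, σ (b j) = a j) h2
    · exact zero_le_one
    · rfl
  · push Not at hex
    rw [sum_eq_zero fun σ _ => if_neg fun h => hex σ h.1 h.2.1 h.2.2]
    positivity

open Classical in
/-- The alternating cycles with `2 (k + 1)` vertices. -/
noncomputable def altCycles (e : Fin c × Bool ↪ α) (e' : Fin c' × Bool ↪ α) (k : ℕ) (σ : Perm α) :
    Finset (OrientedEdges c k × OrientedEdges c' k) := {w | Closes e e' w σ}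

omit [Fintype α] [DecidableEq α] in
open Classical in
theorem card_intersecting_le {p τ : Perm α} {e : Fin c × Bool ↪ α} {e' : Fin c' × Bool ↪ α}
    (he : ∀ t b, p (e (t, b)) = e (t, !b)) (he' : ∀ t b, τ (e' (t, b)) = e' (t, !b)) {k : ℕ}
    (l : ℕ) {σ : Perm α} {w : OrientedEdges c k × OrientedEdges c' k}
    (hw : w ∈ altCycles e e' k σ) :
    #{v ∈ altCycles e e' l σ |
        ¬ Disjoint (Set.range (w.1.vertices e)) (Set.range (v.1.vertices e))} ≤
      if k = l then 2 * (k + 1) else 0 := by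
  have hw := (mem_filter.1 hw).2.isAltCycle he he'
  set I := {v ∈ altCycles e e' l σ |
    ¬ Disjoint (Set.range (w.1.vertices e)) (Set.range (v.1.vertices e))} with hI
  have hmem {v} (hv : v ∈ I) : Closes e e' v σ ∧
      ¬ Disjoint (Set.range (w.1.vertices e)) (Set.range (v.1.vertices e)) := by
    simpa [hI, altCycles] using hv
  split_ifs with hkl
  · calc #I ≤ #(univ.map (w.1.vertices e)) := by
          refine card_le_card_of_injOn (fun v => v.1.vertices e (0, false)) (fun v hv => ?_) ?_
          · obtain ⟨hv, hd⟩ := hmem hv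
            obtain ⟨x, hx⟩ := (hv.isAltCycle he he').range_subset hw (fun hd' => hd hd'.symm)
              ⟨(0, false), rfl⟩
            exact mem_coe.2 (mem_map.2 ⟨x, mem_univ _, hx⟩)
          · intro v hv v' hv' h0
            have hv := (hmem hv).1
            have hv' := (hmem hv').1
            exact hv.snd_eq hv' (OrientedEdges.vertices_injective e l
              ((hv.isAltCycle he he').eq_of_apply_zero_eq (hv'.isAltCycle he he') h0))
      _ = 2 * (k + 1) := by simp [mul_comm]
  · rw [Nat.le_zero, card_eq_zero, eq_empty_iff_forall_notMem]
    intro v hv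
    obtain ⟨hv, hd⟩ := hmem hv
    exact hkl (hw.length_eq (hv.isAltCycle he he') hd)

theorem sum_card_altCycles (e : Fin c × Bool ↪ α) (e' : Fin c' × Bool ↪ α) (k : ℕ) :
    ∑ σ : Perm α, (#(altCycles e e' k σ) : ℝ) =
      Fintype.card (Perm α) * ((Fintype.card (OrientedEdges c k) *
        Fintype.card (OrientedEdges c' k)) /
        (Fintype.card α).descFactorial (2 * (k + 1))) := by
  simp only [altCycles, ← sum_boole]
  rw [sum_comm]
  simp only [sum_perm_closes, sum_const, card_univ, nsmul_eq_mul, Fintype.card_prod, Nat.cast_mul]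
  ring

theorem sum_card_altCycles_mul_le {p τ : Perm α} {e : Fin c × Bool ↪ α} {e' : Fin c' × Bool ↪ α}
    (he : ∀ t b, p (e (t, b)) = e (t, !b)) (he' : ∀ t b, τ (e' (t, b)) = e' (t, !b))
    (hc : 2 * c ≤ Fintype.card α) (hc' : 2 * c' ≤ Fintype.card α) (k l : ℕ) :
    ∑ σ : Perm α, (#(altCycles e e' k σ) : ℝ) * #(altCycles e e' l σ) ≤
      Fintype.card (Perm α) * ((Fintype.card α : ℝ) ^ (2 * (k + 1) + 2 * (l + 1)) /
        (Fintype.card α).descFactorial (2 * (k + 1) + 2 * (l + 1))) +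
      if k = l then 2 * (k + 1) * ∑ σ : Perm α, (#(altCycles e e' k σ) : ℝ) else 0 := by
  classical
  let D (w : OrientedEdges c k × OrientedEdges c' k) (v : OrientedEdges c l × OrientedEdges c' l)
    (σ : Perm α) : ℝ := if Closes e e' w σ ∧ Closes e e' v σ ∧
        Disjoint (Set.range (w.1.vertices e)) (Set.range (v.1.vertices e)) then 1 else 0
  have hpoint (σ : Perm α) : (#(altCycles e e' k σ) : ℝ) * #(altCycles e e' l σ) ≤
      (∑ w, ∑ v, D w v σ) + if k = l then 2 * (k + 1) * (#(altCycles e e' k σ) : ℝ) else 0 := by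
    have hrow (w) (hw : w ∈ altCycles e e' k σ) : (#(altCycles e e' l σ) : ℝ) ≤
        (∑ v, D w v σ) + if k = l then 2 * (k + 1) else 0 := by
      have h1 := card_intersecting_le he he' l hw
      have h2 := card_filter_add_card_filter_not (s := altCycles e e' l σ)
        (fun v => Disjoint (Set.range (w.1.vertices e)) (Set.range (v.1.vertices e)))
      have h3 : ∑ v, D w v σ = (#{v ∈ altCycles e e' l σ |
          Disjoint (Set.range (w.1.vertices e)) (Set.range (v.1.vertices e))} : ℝ) := by
        simp only [D, (mem_filter.1 hw).2, true_and, altCycles, filter_filter, ← sum_boole]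
      rw [h3, ← h2, Nat.cast_add]
      gcongr
    calc (#(altCycles e e' k σ) : ℝ) * #(altCycles e e' l σ)
        = ∑ w ∈ altCycles e e' k σ, (#(altCycles e e' l σ) : ℝ) := by simp
      _ ≤ ∑ w ∈ altCycles e e' k σ, ((∑ v, D w v σ) + if k = l then 2 * (k + 1) else 0) :=
          sum_le_sum hrow
      _ ≤ _ := by
          rw [sum_add_distrib]
          refine add_le_add (sum_le_sum_of_subset_of_nonneg (subset_univ _) fun w _ _ =>
            sum_nonneg fun v _ => ?_) (le_of_eq ?_)
          · simp only [D]
            split_ifs <;> simp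
          · split_ifs <;> simp [mul_comm]
  refine (sum_le_sum fun σ _ => hpoint σ).trans ?_
  rw [sum_add_distrib]
  refine add_le_add ?_ (le_of_eq ?_)
  · have hcard : (Fintype.card (OrientedEdges c k × OrientedEdges c' k) *
        Fintype.card (OrientedEdges c l × OrientedEdges c' l) : ℝ) ≤
        (Fintype.card α : ℝ) ^ (2 * (k + 1) + 2 * (l + 1)) := by
      rw [Fintype.card_prod (OrientedEdges c k), Fintype.card_prod (OrientedEdges c l)]
      have h := Nat.mul_le_mul
        (Nat.mul_le_mul (card_orientedEdges_le hc k) (card_orientedEdges_le hc' k))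
        (Nat.mul_le_mul (card_orientedEdges_le hc l) (card_orientedEdges_le hc' l))
      rw [← pow_add, ← pow_add, ← pow_add, ← two_mul, ← two_mul] at h
      exact_mod_cast h
    calc ∑ σ, ∑ w, ∑ v, D w v σ = ∑ w, ∑ v, ∑ σ, D w v σ := by
          rw [sum_comm]
          exact sum_congr rfl fun w _ => sum_comm
      _ ≤ ∑ w : OrientedEdges c k × OrientedEdges c' k,
          ∑ v : OrientedEdges c l × OrientedEdges c' l, (Fintype.card (Perm α) : ℝ) /
            (Fintype.card α).descFactorial (2 * (k + 1) + 2 * (l + 1)) :=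
          sum_le_sum fun w _ => sum_le_sum fun v _ => sum_perm_closes_closes_le e e' w v
      _ = (Fintype.card (OrientedEdges c k × OrientedEdges c' k) *
            Fintype.card (OrientedEdges c l × OrientedEdges c' l) : ℝ) *
          (Fintype.card (Perm α) /
            (Fintype.card α).descFactorial (2 * (k + 1) + 2 * (l + 1))) := by
          simp only [sum_const, card_univ, nsmul_eq_mul]
          ring
      _ ≤ (Fintype.card α : ℝ) ^ (2 * (k + 1) + 2 * (l + 1)) * (Fintype.card (Perm α) /
            (Fintype.card α).descFactorial (2 * (k + 1) + 2 * (l + 1))) :=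
          mul_le_mul_of_nonneg_right hcard (by positivity)
      _ = _ := by ring
  · split_ifs
    · rw [mul_sum]
    · simp

open Classical in
/-- If `p` and `τ` have `c` and `c'` disjoint `2`-cycles, then the second moment of the number of
unoriented alternating cycles with at most `2 K` vertices bounds the number of conjugates of `τ`
that generate `A_n` together with `p`. -/
theorem card_generating_mul_le_of_pairing {p τ : Perm α} {e : Fin c × Bool ↪ α}
    {e' : Fin c' × Bool ↪ α} (he : ∀ t b, p (e (t, b)) = e (t, !b))
    (he' : ∀ t b, τ (e' (t, b)) = e' (t, !b)) (hα : 3 ≤ Fintype.card α)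
    (hc : 2 * c ≤ Fintype.card α) (hc' : 2 * c' ≤ Fintype.card α) {K : ℕ}
    (hK : 2 * K < Fintype.card α) {μ Q : ℝ}
    (hμ : μ = ∑ k ∈ range K, 1 / (2 * (k + 1) : ℝ) * ((Fintype.card (OrientedEdges c k) *
      Fintype.card (OrientedEdges c' k)) / (Fintype.card α).descFactorial (2 * (k + 1))))
    (hQ : Q = (∑ k ∈ range K, ∑ l ∈ range K, 1 / (2 * (k + 1) : ℝ) * (1 / (2 * (l + 1) : ℝ)) *
      ((Fintype.card α : ℝ) ^ (2 * (k + 1) + 2 * (l + 1)) /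
        (Fintype.card α).descFactorial (2 * (k + 1) + 2 * (l + 1)))) + μ) :
    (#{σ : Perm α | alternatingGroup α ≤ Subgroup.closure {p, σ * τ * σ⁻¹}} : ℝ) * Q ≤
      Fintype.card (Perm α) * (Q - μ ^ 2) := by
  let Y (σ : Perm α) : ℝ := ∑ k ∈ range K, 1 / (2 * (k + 1) : ℝ) * #(altCycles e e' k σ)
  have h₁ : ∑ σ, Y σ = Fintype.card (Perm α) * μ := by
    simp only [Y]
    rw [sum_comm, hμ, mul_sum]
    refine sum_congr rfl fun k _ => ?_
    rw [← mul_sum, sum_card_altCycles]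
    ring
  refine card_mul_le_of_second_moment _ Y (fun σ hσ => ?_) h₁ ?_
  · refine sum_eq_zero fun k hk => ?_
    suffices altCycles e e' k σ = ∅ by simp [this]
    rw [eq_empty_iff_forall_notMem]
    intro w hw
    have hw := (mem_filter.1 hw).2.isAltCycle he he'
    refine not_alternatingGroup_le_closure hα (univ.map (w.1.vertices e))
      (by simp) ?_ (fun x hx => ?_) (fun x hx => ?_) (mem_filter.1 hσ).2
    · have := mem_range.1 hk
      simp only [card_map, card_univ, Fintype.card_prod, Fintype.card_fin, Fintype.card_bool]
      omega
    · simpa using hw.left_mem (by simpa using hx)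
    · simpa using hw.right_mem (by simpa using hx)
  · calc ∑ σ, Y σ ^ 2 = ∑ k ∈ range K, ∑ l ∈ range K, 1 / (2 * (k + 1) : ℝ) *
          (1 / (2 * (l + 1) : ℝ)) *
            ∑ σ : Perm α, (#(altCycles e e' k σ) : ℝ) * #(altCycles e e' l σ) := by
          simp only [Y, sq, sum_mul_sum]
          rw [sum_comm]
          refine sum_congr rfl fun k _ => ?_
          rw [sum_comm]
          refine sum_congr rfl fun l _ => ?_
          rw [mul_sum]
          refine sum_congr rfl fun σ _ => ?_
          ring
      _ ≤ ∑ k ∈ range K, ∑ l ∈ range K, 1 / (2 * (k + 1) : ℝ) * (1 / (2 * (l + 1) : ℝ)) *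
          (Fintype.card (Perm α) * ((Fintype.card α : ℝ) ^ (2 * (k + 1) + 2 * (l + 1)) /
            (Fintype.card α).descFactorial (2 * (k + 1) + 2 * (l + 1))) +
          if k = l then 2 * (k + 1) * ∑ σ : Perm α, (#(altCycles e e' k σ) : ℝ) else 0) :=
          sum_le_sum fun k _ => sum_le_sum fun l _ => mul_le_mul_of_nonneg_left
            (sum_card_altCycles_mul_le he he' hc hc' k l) (by positivity)
      _ = Fintype.card (Perm α) * Q := by
          rw [hQ, mul_add, ← h₁]
          simp only [mul_add, sum_add_distrib, mul_ite, mul_zero, Y]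
          congr 1
          · simp only [mul_sum]
            exact sum_congr rfl fun k _ => sum_congr rfl fun l _ => by ring
          · rw [sum_comm (s := univ)]
            refine sum_congr rfl fun k hk => ?_
            rw [sum_ite_eq, if_pos hk, ← mul_sum]
            field_simp

end AlternatingCycles

section Classes
variable {α : Type*} [Fintype α] [DecidableEq α]

open Classical in
/-- Averaging over a conjugacy class is averaging over all conjugates. -/
theorem card_conj_mul_sum_conj (τ : Perm α) (f : Perm α → ℝ) :
    #{ρ : Perm α | IsConj τ ρ} * ∑ σ : Perm α, f (σ * τ * σ⁻¹) =
      Fintype.card (Perm α) * ∑ ρ : Perm α with IsConj τ ρ, f ρ := by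
  have h1 : ∀ ρ ∈ ({ρ : Perm α | IsConj τ ρ} : Finset (Perm α)),
      ∑ σ : Perm α, f (σ * ρ * σ⁻¹) = ∑ σ : Perm α, f (σ * τ * σ⁻¹) := by
    intro ρ hρ
    obtain ⟨g, rfl⟩ := isConj_iff.1 (mem_filter.1 hρ).2
    refine Fintype.sum_equiv (Equiv.mulRight g) _ _ fun σ => ?_
    simp [mul_assoc]
  have h2 (σ : Perm α) : ∑ ρ : Perm α with IsConj τ ρ, f (σ * ρ * σ⁻¹) =
      ∑ ρ : Perm α with IsConj τ ρ, f ρ := by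
    refine sum_equiv (MulAut.conj σ).toEquiv (fun ρ => ?_) fun ρ _ => rfl
    have : IsConj ρ (σ * ρ * σ⁻¹) := isConj_iff.2 ⟨σ, rfl⟩
    simp only [mem_filter_univ]
    exact ⟨fun h => h.trans this, fun h => h.trans this.symm⟩
  rw [← nsmul_eq_mul, ← sum_const, ← sum_congr rfl h1, sum_comm]
  simp only [h2, sum_const, card_univ, nsmul_eq_mul]

end Classes

open Classical in
theorem genProb_le {n : ℕ} {π π' : Perm (Fin n)} {B : ℝ}
    (h : ∀ p, IsConj π p → (#{σ : Perm (Fin n) |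
      alternatingGroup (Fin n) ≤ Subgroup.closure {p, σ * π' * σ⁻¹}} : ℝ) ≤
        Fintype.card (Perm (Fin n)) * B) : genProb n π π' ≤ B := by
  have hN : (0 : ℝ) < Fintype.card (Perm (Fin n)) := by exact_mod_cast Fintype.card_pos
  have hpos (ρ : Perm (Fin n)) : (0 : ℝ) < #{σ : Perm (Fin n) | IsConj ρ σ} := by
    exact_mod_cast card_pos.2 ⟨ρ, mem_filter.2 ⟨mem_univ _, IsConj.refl ρ⟩⟩
  rw [genProb]
  simp only [Nat.card_eq_fintype_card, Fintype.card_subtype]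
  rw [div_le_iff₀ (mul_pos (hpos π) (hpos π'))]
  have hnum : (#{x : Perm (Fin n) × Perm (Fin n) | IsConj π x.1 ∧ IsConj π' x.2 ∧
      alternatingGroup (Fin n) ≤ Subgroup.closure {x.1, x.2}} : ℝ) =
      ∑ p : Perm (Fin n) with IsConj π p, ∑ ρ : Perm (Fin n) with IsConj π' ρ,
        if alternatingGroup (Fin n) ≤ Subgroup.closure {p, ρ} then (1 : ℝ) else 0 := by
    rw [← sum_boole, Fintype.sum_prod_type, sum_filter]
    refine sum_congr rfl fun p _ => ?_
    rw [sum_filter]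
    split_ifs with hp
    · simp only [hp, true_and, ite_and]
    · simp only [hp, false_and, if_false, sum_const_zero]
  rw [hnum]
  calc _ ≤ ∑ p : Perm (Fin n) with IsConj π p, B * #{σ : Perm (Fin n) | IsConj π' σ} := by
        refine sum_le_sum fun p hp => le_of_mul_le_mul_left ?_ hN
        rw [← card_conj_mul_sum_conj π' fun ρ =>
          if alternatingGroup (Fin n) ≤ Subgroup.closure {p, ρ} then (1 : ℝ) else 0, sum_boole]
        have := mul_le_mul_of_nonneg_left (h p (mem_filter.1 hp).2) (hpos π').le
        linarith
    _ = _ := by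
        rw [sum_const, nsmul_eq_mul]
        ring

theorem genProb_nonneg (n : ℕ) (π π' : Perm (Fin n)) : 0 ≤ genProb n π π' := by
  unfold genProb
  positivity

theorem genProb_comm (n : ℕ) (π π' : Perm (Fin n)) : genProb n π π' = genProb n π' π := by
  unfold genProb
  rw [mul_comm]
  congr 2
  refine Nat.card_congr ((Equiv.prodComm _ _).subtypeEquiv fun x => ?_)
  simp only [Equiv.prodComm_apply, Prod.fst_swap, Prod.snd_swap, Set.pair_comm x.1]
  tauto

section CycleCount
variable {n : ℕ}

theorem cycleCount_one (π : Perm (Fin n)) : cycleCount π 1 = #{x | π x = x} := by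
  rw [cycleCount, if_pos rfl, Nat.card_eq_fintype_card, ← Set.toFinset_card]
  congr
  ext
  simp [Function.IsFixedPt]

theorem cycleCount_eq_of_isConj {π p : Perm (Fin n)} (h : IsConj π p) (j : ℕ) :
    cycleCount p j = cycleCount π j := by
  have ht := Perm.isConj_iff_cycleType_eq.1 h
  unfold cycleCount
  split_ifs
  · rw [Nat.card_eq_fintype_card, Nat.card_eq_fintype_card, Perm.card_fixedPoints,
      Perm.card_fixedPoints, ht]
  · rw [ht]

theorem exists_embedding_fixed (τ : Perm (Fin n)) :
    ∃ b : Fin (cycleCount τ 1) × Fin 1 ↪ Fin n, ∀ t j, τ (b (t, j)) = b (t, j) := by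
  let f := ({x | τ x = x} : Finset (Fin n)).equivFin
  rw [cycleCount_one]
  refine ⟨⟨fun x => f.symm x.1, fun x y h => ?_⟩, fun t j => ?_⟩
  · have := f.symm.injective (Subtype.ext h)
    exact Prod.ext this (Subsingleton.elim _ _)
  · exact (mem_filter.1 (f.symm t).2).2

theorem exists_embedding_pairing (τ : Perm (Fin n)) :
    ∃ e : Fin (cycleCount τ 2) × Bool ↪ Fin n, ∀ t b, τ (e (t, b)) = e (t, !b) := by
  let T : Finset (Perm (Fin n)) := {g ∈ τ.cycleFactorsFinset | #g.support = 2}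
  have hT : cycleCount τ 2 = #T := by
    rw [cycleCount, if_neg (by norm_num), Perm.cycleType_def, Multiset.count_map]
    simp only [T, Finset.card, Finset.filter, Function.comp_apply, eq_comm]
    congr
  rw [hT]
  let f := T.equivFin
  have hmem (t : Fin #T) : (f.symm t : Perm (Fin n)) ∈ τ.cycleFactorsFinset :=
    (mem_filter.1 (f.symm t).2).1
  have hcard (t : Fin #T) : #(f.symm t : Perm (Fin n)).support = 2 :=
    (mem_filter.1 (f.symm t).2).2
  have hx (t : Fin #T) : ∃ x, x ∈ (f.symm t : Perm (Fin n)).support :=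
    card_pos.1 (by rw [hcard]; norm_num)
  choose x hx using hx
  have hne (t : Fin #T) : τ (x t) ≠ x t := by
    have := Perm.mem_cycleFactorsFinset_support_le (hmem t) (hx t)
    exact Perm.mem_support.1 this
  have happly (t : Fin #T) : ∀ y ∈ (f.symm t : Perm (Fin n)).support,
      (f.symm t : Perm (Fin n)) y = τ y := (Perm.mem_cycleFactorsFinset_iff.1 (hmem t)).2
  have hsupp (t : Fin #T) : τ (x t) ∈ (f.symm t : Perm (Fin n)).support := by
    rw [← happly t _ (hx t)]
    exact Perm.apply_mem_support.2 (hx t)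
  have hinv (t : Fin #T) : τ (τ (x t)) = x t := by
    obtain ⟨a, b, hab, hswap⟩ := Perm.card_support_eq_two.1 (hcard t)
    rw [← happly t _ (hsupp t), ← happly t _ (hx t), hswap, swap_apply_self]
  have hmem' (t : Fin #T) (b : Bool) :
      (if b then τ (x t) else x t) ∈ (f.symm t : Perm (Fin n)).support := by
    split_ifs
    · exact hsupp t
    · exact hx t
  refine ⟨⟨fun y => if y.2 then τ (x y.1) else x y.1, ?_⟩, ?_⟩
  · rintro ⟨t, b⟩ ⟨t', b'⟩ h
    have h : (if b then τ (x t) else x t) = if b' then τ (x t') else x t' := h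
    have htt : t = t' := by
      by_contra hne'
      have hd := Perm.cycleFactorsFinset_pairwise_disjoint τ (hmem t) (hmem t')
        fun h => hne' (f.symm.injective (Subtype.ext h))
      exact Finset.disjoint_left.1 hd.disjoint_support (hmem' t b) (h ▸ hmem' t' b')
    subst htt
    have := hne t
    have := this.symm
    cases b <;> cases b' <;> simp_all
  · rintro t (_ | _)
    · rfl
    · exact hinv t

theorem two_mul_cycleCount_two_le (τ : Perm (Fin n)) : 2 * cycleCount τ 2 ≤ n := by
  obtain ⟨e, -⟩ := exists_embedding_pairing τ
  simpa [mul_comm] using Fintype.card_le_of_embedding e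

theorem genProb_mul_le_one {π π' : Perm (Fin n)} (hn : 3 ≤ n) {m q : ℕ} (hq : 1 ≤ q) (hqn : q < n)
    (b : Fin m × Fin q ↪ Fin n) (hb : ∀ t j, ∃ j', π' (b (t, j)) = b (t, j')) :
    genProb n π π' * (1 + m * ((cycleCount π 1).descFactorial q / n.descFactorial q : ℝ)) ≤ 1 := by
  have hpos : 0 < 1 + m * ((cycleCount π 1).descFactorial q / n.descFactorial q : ℝ) := by
    positivity
  rw [← le_div_iff₀ hpos]
  refine genProb_le fun p hp => ?_
  have h := card_generating_mul_le_of_fixed (by simpa using hn) hq (by simpa using hqn) p π' b hb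
    {x | p x = x} (by simp)
  rw [← cycleCount_one, cycleCount_eq_of_isConj hp, Fintype.card_fin] at h
  rw [mul_one_div, le_div_iff₀ hpos]
  convert h

theorem genProb_mul_fixed_mul_fixed_le {π π' : Perm (Fin n)} (hn : 3 ≤ n) :
    genProb n π π' * (cycleCount π 1 * cycleCount π' 1) ≤ n := by
  obtain ⟨b, hb⟩ := exists_embedding_fixed π'
  have h := genProb_mul_le_one (π := π) hn le_rfl (by omega) b fun t j => ⟨j, hb t j⟩
  have hn' : (0 : ℝ) < n := by positivity
  simp only [Nat.descFactorial_one] at h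
  rw [← div_le_one hn']
  refine le_trans ?_ h
  rw [mul_add, mul_one]
  have := genProb_nonneg n π π'
  have heq : genProb n π π' * (cycleCount π' 1 * ((cycleCount π 1 : ℝ) / n)) =
    genProb n π π' * (cycleCount π 1 * cycleCount π' 1) / n := by ring
  linarith

theorem genProb_mul_fixed_sq_mul_pairs_le {π π' : Perm (Fin n)} (hn : 3 ≤ n) :
    genProb n π π' * (cycleCount π 1 * (cycleCount π 1 - 1) * cycleCount π' 2) ≤ (n : ℝ) ^ 2 := by
  obtain ⟨e, he⟩ := exists_embedding_pairing π'
  have h := genProb_mul_le_one (π := π) (π' := π') (q := 2) hn (by norm_num) (by omega)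
    (((Equiv.refl _).prodCongr finTwoEquiv).toEmbedding.trans e)
    fun t j => ⟨finTwoEquiv.symm (!finTwoEquiv j), by simp [he]⟩
  have hn' : (3 : ℝ) ≤ n := by exact_mod_cast hn
  simp only [Nat.cast_descFactorial_two] at h
  have hnn : (0 : ℝ) < n * (n - 1) := by nlinarith
  have h0 := genProb_nonneg n π π'
  have heq : genProb n π π' * (cycleCount π' 2 * ((cycleCount π 1 : ℝ) * (cycleCount π 1 - 1) /
      (n * (n - 1)))) = genProb n π π' *
      (cycleCount π 1 * (cycleCount π 1 - 1) * cycleCount π' 2) / (n * (n - 1)) := by ring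
  rw [mul_add, heq] at h
  have h1 : genProb n π π' *
      (cycleCount π 1 * (cycleCount π 1 - 1) * cycleCount π' 2) / (n * (n - 1)) ≤ 1 := by linarith
  rw [div_le_one hnn] at h1
  nlinarith

theorem fixed_mul_sqrt_pairs_le {π π' : Perm (Fin n)} (hn : 3 ≤ n) {p : ℝ} (hp : 0 < p)
    (hgen : p ≤ genProb n π π') :
    cycleCount π 1 * √(cycleCount π' 2) ≤ (1 + 2 / p) * n := by
  have h := genProb_mul_fixed_sq_mul_pairs_le (π := π) (π' := π') hn
  have hc' : (cycleCount π' 2 : ℝ) ≤ n := by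
    exact_mod_cast (by have := two_mul_cycleCount_two_le π'; omega : cycleCount π' 2 ≤ n)
  have hn' : (1 : ℝ) ≤ n := by exact_mod_cast (by omega : 1 ≤ n)
  refine abs_le_of_sq_le_sq' ?_ (by positivity) |>.2
  rw [mul_pow, Real.sq_sqrt (Nat.cast_nonneg _), mul_pow]
  have hx0 : (0 : ℝ) ≤ 2 / p := by positivity
  have hone : 1 + 2 / p ≤ (1 + 2 / p) ^ 2 := by nlinarith
  refine le_trans ?_ (mul_le_mul_of_nonneg_right hone (sq_nonneg _))
  rcases Nat.lt_or_ge (cycleCount π 1) 2 with hlt | hge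
  · have hc : (cycleCount π 1 : ℝ) ≤ 1 := by exact_mod_cast (by omega : cycleCount π 1 ≤ 1)
    have h1 : (cycleCount π 1 : ℝ) ^ 2 ≤ 1 := pow_le_one₀ (Nat.cast_nonneg _) hc
    calc (cycleCount π 1 : ℝ) ^ 2 * cycleCount π' 2 ≤ 1 * n := by gcongr
      _ ≤ (1 + 2 / p) * n ^ 2 := by
          gcongr
          · linarith
          · nlinarith
  · have hc : (2 : ℝ) ≤ cycleCount π 1 := by exact_mod_cast hge
    have h2 : p * (cycleCount π 1 * (cycleCount π 1 - 1) * cycleCount π' 2) ≤ (n : ℝ) ^ 2 := by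
      refine le_trans (mul_le_mul_of_nonneg_right hgen ?_) h
      have : (0 : ℝ) ≤ (cycleCount π 1 : ℝ) - 1 := by linarith
      positivity
    have h3 : (cycleCount π 1 * (cycleCount π 1 - 1) * cycleCount π' 2 : ℝ) ≤ n ^ 2 / p := by
      rw [le_div_iff₀ hp]
      linarith
    have h4 : (cycleCount π 1 : ℝ) ^ 2 * cycleCount π' 2 ≤
        2 * (cycleCount π 1 * (cycleCount π 1 - 1) * cycleCount π' 2) := by
      rw [← mul_assoc]
      gcongr
      nlinarith
    calc _ ≤ 2 * ((n : ℝ) ^ 2 / p) := by linarith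
      _ = 2 / p * n ^ 2 := by ring
      _ ≤ _ := by gcongr; linarith

theorem genProb_le_of_pairing {π π' : Perm (Fin n)} (hn : 3 ≤ n) {K : ℕ} (hK : 2 * K < n)
    {μ Q : ℝ} (hμ : μ = ∑ k ∈ range K, 1 / (2 * (k + 1) : ℝ) *
      ((Fintype.card (OrientedEdges (cycleCount π 2) k) *
        Fintype.card (OrientedEdges (cycleCount π' 2) k)) / n.descFactorial (2 * (k + 1))))
    (hQ : Q = (∑ k ∈ range K, ∑ l ∈ range K, 1 / (2 * (k + 1) : ℝ) * (1 / (2 * (l + 1) : ℝ)) *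
      ((n : ℝ) ^ (2 * (k + 1) + 2 * (l + 1)) / n.descFactorial (2 * (k + 1) + 2 * (l + 1)))) + μ)
    (hQ0 : 0 < Q) : genProb n π π' ≤ (Q - μ ^ 2) / Q := by
  refine genProb_le fun p hp => ?_
  obtain ⟨e', he'⟩ := exists_embedding_pairing π'
  obtain ⟨e, he⟩ := exists_embedding_pairing p
  rw [← mul_div_assoc, le_div_iff₀ hQ0]
  rw [← cycleCount_eq_of_isConj hp 2] at hμ
  exact card_generating_mul_le_of_pairing he he' (by simpa using hn)
    (by simpa using two_mul_cycleCount_two_le p) (by simpa using two_mul_cycleCount_two_le π')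
    (by simpa using hK) (by simpa using hμ) (by simpa using hQ)

end CycleCount

section Asymptotics

theorem tendsto_pow_mul_descFactorial_div {c n : ℕ → ℕ} (a : ℝ) (ha : 0 ≤ a)
    (hn : Tendsto n atTop atTop) (h : Tendsto (fun j => a * c j / (n j : ℝ)) atTop (𝓝 1)) (m : ℕ) :
    Tendsto (fun j => a ^ m * (c j).descFactorial m / (n j : ℝ) ^ m) atTop (𝓝 1) := by
  induction m with
  | zero => simp
  | succ m ih =>
    have hn' : Tendsto (fun j => (n j : ℝ)) atTop atTop := tendsto_natCast_atTop_atTop.comp hn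
    have hstep : Tendsto (fun j => a * (c j - m : ℕ) / (n j : ℝ)) atTop (𝓝 1) := by
      refine tendsto_of_tendsto_of_tendsto_of_le_of_le
        (g := fun j => a * c j / (n j : ℝ) - a * m / n j) (h := fun j => a * c j / (n j : ℝ))
        ?_ h (fun j => ?_) (fun j => ?_)
      · simpa using h.sub (hn'.const_div_atTop (a * m))
      · have : (c j : ℝ) ≤ (c j - m : ℕ) + m := by exact_mod_cast le_tsub_add
        simp only
        rw [← sub_div, ← mul_sub]
        gcongr
        linarith
      · simp only
        gcongr
        omega
    have := hstep.mul ih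
    rw [mul_one] at this
    refine this.congr fun j => ?_
    rw [Nat.descFactorial_succ, Nat.cast_mul, pow_succ, pow_succ, div_mul_div_comm]
    congr 1 <;> ring

theorem tendsto_descFactorial_div_pow {n : ℕ → ℕ} (hn : Tendsto n atTop atTop) (m : ℕ) :
    Tendsto (fun j => ((n j).descFactorial m : ℝ) / (n j : ℝ) ^ m) atTop (𝓝 1) := by
  have h : Tendsto (fun j => 1 * (n j : ℝ) / (n j : ℝ)) atTop (𝓝 1) := by
    refine tendsto_const_nhds.congr' ?_
    filter_upwards [hn.eventually_ge_atTop 1] with j hj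
    rw [one_mul, div_self (by positivity)]
  simpa using tendsto_pow_mul_descFactorial_div 1 zero_le_one hn h m

theorem tendsto_orientedEdges_mul_div {c c' n : ℕ → ℕ} (hn : Tendsto n atTop atTop)
    (hc : Tendsto (fun j => 2 * c j / (n j : ℝ)) atTop (𝓝 1))
    (hc' : Tendsto (fun j => 2 * c' j / (n j : ℝ)) atTop (𝓝 1)) (k : ℕ) :
    Tendsto (fun j => (Fintype.card (OrientedEdges (c j) k) *
      Fintype.card (OrientedEdges (c' j) k) : ℝ) / (n j).descFactorial (2 * (k + 1))) atTop
      (𝓝 1) := by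
  have h := ((tendsto_pow_mul_descFactorial_div 2 zero_le_two hn hc (k + 1)).mul
    (tendsto_pow_mul_descFactorial_div 2 zero_le_two hn hc' (k + 1))).div
      (tendsto_descFactorial_div_pow hn (2 * (k + 1))) one_ne_zero
  rw [mul_one, div_one] at h
  refine h.congr' ?_
  filter_upwards [hn.eventually_ge_atTop 1] with j hj
  have hj' : (n j : ℝ) ^ (k + 1) ≠ 0 := by positivity
  simp only [Pi.div_apply, card_orientedEdges]
  rw [div_mul_div_comm, ← pow_add, ← two_mul, div_div_div_cancel_right₀ (by positivity)]
  push_cast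
  ring

theorem genProb_add_one_le_of_tendsto {π π' : (n : ℕ) → Perm (Fin n)} {φ : ℕ → ℕ}
    (hφ : Tendsto φ atTop atTop)
    (hc : Tendsto (fun j => 2 * cycleCount (π (φ j)) 2 / (φ j : ℝ)) atTop (𝓝 1))
    (hc' : Tendsto (fun j => 2 * cycleCount (π' (φ j)) 2 / (φ j : ℝ)) atTop (𝓝 1)) {p : ℝ}
    (hp : ∀ᶠ j in atTop, p ≤ genProb (φ j) (π (φ j)) (π' (φ j))) {K : ℕ} (hK : 0 < K) :
    p * (∑ k ∈ range K, 1 / (2 * (k + 1) : ℝ) + 1) ≤ 1 := by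
  set h : ℝ := ∑ k ∈ range K, 1 / (2 * (k + 1) : ℝ)
  have hpos : 0 < h := sum_pos (fun k _ => by positivity) ⟨0, mem_range.2 hK⟩
  let μ (j : ℕ) : ℝ := ∑ k ∈ range K, 1 / (2 * (k + 1) : ℝ) *
    ((Fintype.card (OrientedEdges (cycleCount (π (φ j)) 2) k) *
      Fintype.card (OrientedEdges (cycleCount (π' (φ j)) 2) k)) /
        (φ j).descFactorial (2 * (k + 1)))
  let Q (j : ℕ) : ℝ := (∑ k ∈ range K, ∑ l ∈ range K, 1 / (2 * (k + 1) : ℝ) *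
    (1 / (2 * (l + 1) : ℝ)) * ((φ j : ℝ) ^ (2 * (k + 1) + 2 * (l + 1)) /
      (φ j).descFactorial (2 * (k + 1) + 2 * (l + 1)))) + μ j
  have hμ : Tendsto μ atTop (𝓝 h) := by
    refine tendsto_finsetSum _ fun k _ => ?_
    simpa using (tendsto_orientedEdges_mul_div hφ hc hc' k).const_mul (1 / (2 * (k + 1) : ℝ))
  have hQ : Tendsto Q atTop (𝓝 (h * h + h)) := by
    refine Tendsto.add ?_ hμ
    rw [sum_mul_sum]
    refine tendsto_finsetSum _ fun k _ => tendsto_finsetSum _ fun l _ => ?_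
    have h1 := (tendsto_descFactorial_div_pow hφ (2 * (k + 1) + 2 * (l + 1))).inv₀ one_ne_zero
    simpa using h1.const_mul (1 / (2 * (k + 1) : ℝ) * (1 / (2 * (l + 1) : ℝ)))
  have hle : p * (h * h + h) ≤ h * h + h - h ^ 2 := by
    refine le_of_tendsto_of_tendsto (hQ.const_mul p) (hQ.sub (hμ.pow 2)) ?_
    filter_upwards [hp, hQ.eventually (lt_mem_nhds (by positivity : 0 < h * h + h)),
      hφ.eventually_ge_atTop (2 * K + 3)] with j hpj hQj hj
    have := hpj.trans (genProb_le_of_pairing (by omega) (by omega) rfl rfl hQj)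
    rwa [le_div_iff₀ hQj] at this
  refine le_of_mul_le_mul_right ?_ hpos
  linarith

theorem limsup_pairs_lt_one {π π' : (n : ℕ) → Perm (Fin n)} {p : ℝ} (hp : 0 < p)
    (hgen : ∀ᶠ n in atTop, p ≤ genProb n (π n) (π' n)) :
    limsup (fun n => ((cycleCount (π n) 2 : ℝ) + (cycleCount (π' n) 2 : ℝ)) / n) atTop < 1 := by
  by_contra! hlim
  have hfreq (j : ℕ) : ∃ᶠ n : ℕ in atTop, 1 - 1 / ((j : ℝ) + 1) <
      ((cycleCount (π n) 2 : ℝ) + (cycleCount (π' n) 2 : ℝ)) / n := by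
    refine frequently_lt_of_lt_limsup ?_ (lt_of_lt_of_le ?_ hlim)
    · exact isCoboundedUnder_le_of_le atTop (x := 0) fun n => by positivity
    · have : 0 < 1 / ((j : ℝ) + 1) := by positivity
      linarith
  obtain ⟨φ, hφ, hlt⟩ := extraction_forall_of_frequently hfreq
  have hupper (τ : (n : ℕ) → Perm (Fin n)) (n : ℕ) : 2 * cycleCount (τ n) 2 / (n : ℝ) ≤ 1 :=
    div_le_one_of_le₀ (by exact_mod_cast two_mul_cycleCount_two_le (τ n)) (Nat.cast_nonneg _)
  have hlower : Tendsto (fun j : ℕ => 1 - 2 * (1 / ((j : ℝ) + 1))) atTop (𝓝 1) := by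
    simpa using (tendsto_one_div_add_atTop_nhds_zero_nat (𝕜 := ℝ)).const_mul 2 |>.const_sub 1
  have hc : Tendsto (fun j => 2 * cycleCount (π (φ j)) 2 / (φ j : ℝ)) atTop (𝓝 1) := by
    refine tendsto_of_tendsto_of_tendsto_of_le_of_le hlower tendsto_const_nhds (fun j => ?_)
      fun j => hupper π (φ j)
    have h1 := hlt j
    have h2 := hupper π' (φ j)
    rw [add_div] at h1
    rw [mul_div_assoc] at h2
    simp only
    rw [mul_div_assoc]
    linarith
  have hc' : Tendsto (fun j => 2 * cycleCount (π' (φ j)) 2 / (φ j : ℝ)) atTop (𝓝 1) := by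
    refine tendsto_of_tendsto_of_tendsto_of_le_of_le hlower tendsto_const_nhds (fun j => ?_)
      fun j => hupper π' (φ j)
    have h1 := hlt j
    have h2 := hupper π (φ j)
    rw [add_div] at h1
    rw [mul_div_assoc] at h2
    simp only
    rw [mul_div_assoc]
    linarith
  obtain ⟨K, hK, hK0⟩ := ((Real.tendsto_sum_range_one_div_nat_succ_atTop.eventually_ge_atTop
    (2 / p)).and (eventually_gt_atTop 0)).exists
  have h := genProb_add_one_le_of_tendsto hφ.tendsto_atTop hc hc'
    (hφ.tendsto_atTop.eventually hgen) hK0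
  have hhalf : ∑ k ∈ range K, 1 / (2 * (k + 1) : ℝ) =
      (∑ k ∈ range K, 1 / ((k : ℝ) + 1)) / 2 := by
    rw [sum_div]
    exact sum_congr rfl fun k _ => by rw [div_div, mul_comm]
  rw [hhalf] at h
  rw [div_le_iff₀ hp] at hK
  linarith

theorem isBigO_fixed_add_sqrt_pairs {π π' : (n : ℕ) → Perm (Fin n)} {p : ℝ} (hp : 0 < p)
    (hgen : ∀ᶠ n in atTop, p ≤ genProb n (π n) (π' n)) :
    (fun n => ((cycleCount (π n) 1 : ℝ) + √(cycleCount (π n) 2)) *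
      ((cycleCount (π' n) 1 : ℝ) + √(cycleCount (π' n) 2))) =O[atTop] fun n => (n : ℝ) := by
  refine IsBigO.of_bound (1 / p + 2 * (1 + 2 / p) + 1) ?_
  filter_upwards [hgen, eventually_ge_atTop 3] with n hpn hn
  have h11 : (cycleCount (π n) 1 * cycleCount (π' n) 1 : ℝ) ≤ 1 / p * n := by
    have h := mul_le_mul_of_nonneg_right hpn
      (by positivity : (0 : ℝ) ≤ cycleCount (π n) 1 * cycleCount (π' n) 1)
    rw [one_div_mul_eq_div, le_div_iff₀ hp, mul_comm]
    exact h.trans (genProb_mul_fixed_mul_fixed_le hn)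
  have h12 := fixed_mul_sqrt_pairs_le hn hp hpn
  have h21 := fixed_mul_sqrt_pairs_le hn hp (genProb_comm n (π n) (π' n) ▸ hpn)
  have h22 : √(cycleCount (π n) 2) * √(cycleCount (π' n) 2) ≤ n := by
    have hle (τ : Perm (Fin n)) : cycleCount τ 2 ≤ n := by
      have := two_mul_cycleCount_two_le τ
      omega
    calc _ ≤ √(n : ℝ) * √(n : ℝ) := by
          gcongr <;> exact hle _
      _ = n := Real.mul_self_sqrt (Nat.cast_nonneg n)
  rw [Real.norm_of_nonneg (by positivity), Real.norm_of_nonneg (by positivity)]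
  nlinarith

end Asymptotics

end Auxiliary

/-- If two independent uniformly random elements of the classes of `π n` and `π' n` generate a
subgroup containing `A_n` with probability bounded away from `0`, then
`(c₁ + c₂^{1/2})(c'₁ + c'₂^{1/2}) = O(n)` and `limsup (c₂ + c'₂)/n < 1`. -/
theorem random_generation_positive_probability_converse
    (π π' : (n : ℕ) → Equiv.Perm (Fin n))
    (h : 0 < liminf (fun n => genProb n (π n) (π' n)) atTop) :
    ((fun n => ((cycleCount (π n) 1 : ℝ) + Real.sqrt (cycleCount (π n) 2)) *
        ((cycleCount (π' n) 1 : ℝ) + Real.sqrt (cycleCount (π' n) 2))) =O[atTop]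
        fun n => (n : ℝ)) ∧
    limsup (fun n => ((cycleCount (π n) 2 : ℝ) + (cycleCount (π' n) 2 : ℝ)) / n) atTop < 1 := by
  obtain ⟨p, hp, hlt⟩ := exists_between h
  have hgen : ∀ᶠ n in atTop, p ≤ genProb n (π n) (π' n) :=
    (eventually_lt_of_lt_liminf hlt
      (isBoundedUnder_of ⟨0, fun n => genProb_nonneg n (π n) (π' n)⟩)).mono fun _ => le_of_lt
  exact ⟨isBigO_fixed_add_sqrt_pairs hp hgen, limsup_pairs_lt_one hp hgen⟩
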